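/- Let d ∈ ℕ, 1 < p ≤ 2, 0 < θ ≤ 2, θ ≤ η ≤ ∞ and r > 1/p + 1/θ − 1. Then σ_m(S^r_{p,θ}B)_{A_η} ≍ m^{−(r + 1 − 1/p − 1/η)} · (log* m)^{(d−1)(r + 1 − 1/p − 1/θ)}. -/

import Mathlib

open MeasureTheory Real ENNReal

noncomputable section

namespace Paper

/-- The fundamental domain `[0,1)^d` of the `d`-dimensional torus `𝕋^d`. -/
def cube (d : ℕ) : Set (Fin d → ℝ) := Set.univ.pi fun _ => Set.Ico (0:ℝ) 1

/-- The trigonometric character `x ↦ e^{2π i k·x}`. -/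
def expk (d : ℕ) (k : Fin d → ℤ) (x : Fin d → ℝ) : ℂ :=
  Complex.exp (((2 * Real.pi * ∑ i, (k i : ℝ) * x i : ℝ) : ℂ) * Complex.I)

/-- Fourier coefficient `f̂(k) = ∫_{[0,1)^d} f(x) e^{-2π i k·x} dx`. -/
def fCoeff (d : ℕ) (f : (Fin d → ℝ) → ℂ) (k : Fin d → ℤ) : ℂ :=
  ∫ x in cube d, f x * expk d (-k) x

/-- The `L_q` (quasi-)norm on the torus, `q ∈ (0,∞]`, valued in `ℝ≥0∞`
(for `q = ∞` this is the essential supremum). -/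
def LqNorm (d : ℕ) (q : ℝ≥0∞) (f : (Fin d → ℝ) → ℂ) : ℝ≥0∞ :=
  eLpNorm f q (volume.restrict (cube d))

/-- The weight `∏_{i=1}^d (1+|k_i|)`. -/
def wt (d : ℕ) (k : Fin d → ℤ) : ℝ := ∏ i, (1 + |(k i : ℝ)|)

/-- The weighted Wiener (quasi-)norm `‖f‖_{S^r_θ A}`
(with the sup modification for `θ = ∞`); `A_θ` corresponds to `r = 0`,
the Wiener algebra `A` to `r = 0`, `θ = 1`. -/
def wienerNorm (d : ℕ) (r : ℝ) (θ : ℝ≥0∞) (f : (Fin d → ℝ) → ℂ) : ℝ≥0∞ :=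
  if θ = ∞ then ⨆ k : Fin d → ℤ, ENNReal.ofReal (wt d k ^ r) * (‖fCoeff d f k‖₊ : ℝ≥0∞)
  else (∑' k : Fin d → ℤ,
      (ENNReal.ofReal (wt d k ^ r) * (‖fCoeff d f k‖₊ : ℝ≥0∞)) ^ θ.toReal) ^ (1 / θ.toReal)

/-- Trigonometric polynomials with at most `m` terms. -/
def trigPoly (d m : ℕ) : Set ((Fin d → ℝ) → ℂ) :=
  {s | ∃ (Λ : Finset (Fin d → ℤ)) (a : (Fin d → ℤ) → ℂ),
    Λ.card ≤ m ∧ s = fun x => ∑ k ∈ Λ, a k * expk d k x}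

/-- Best `m`-term trigonometric approximation error of `f`, error measured by `X`. -/
def sigmaF (d m : ℕ) (X : ((Fin d → ℝ) → ℂ) → ℝ≥0∞) (f : (Fin d → ℝ) → ℂ) : ℝ≥0∞ :=
  ⨅ s ∈ trigPoly d m, X (f - s)

/-- The unit ball of the space (inside `L₁(𝕋^d)`) with (quasi-)norm `N`. -/
def unitBall (d : ℕ) (N : ((Fin d → ℝ) → ℂ) → ℝ≥0∞) : Set ((Fin d → ℝ) → ℂ) :=
  {f | IntegrableOn f (cube d) ∧ N f ≤ 1}

/-- Best `m`-term trigonometric width of the unit ball of `N`, error measured by `X`. -/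
def sigmaClass (d m : ℕ) (N X : ((Fin d → ℝ) → ℂ) → ℝ≥0∞) : ℝ≥0∞ :=
  ⨆ f ∈ unitBall d N, sigmaF d m X f

/-- `log*(m) = max (log₂ m) 1`. -/
def logStar (m : ℕ) : ℝ := max (Real.logb 2 m) 1

/-- Two-sided asymptotic equivalence `a_m ≍ b_m`. -/
def IsAsympEquiv (a : ℕ → ℝ≥0∞) (b : ℕ → ℝ) : Prop :=
  ∃ c C : ℝ, 0 < c ∧ 0 < C ∧ ∃ m₀ : ℕ, ∀ m : ℕ, m₀ ≤ m →
    ENNReal.ofReal (c * b m) ≤ a m ∧ a m ≤ ENNReal.ofReal (C * b m)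

/-- One-sided asymptotic bound `a_m ≲ b_m`. -/
def IsAsympLe (a : ℕ → ℝ≥0∞) (b : ℕ → ℝ) : Prop :=
  ∃ C : ℝ, 0 < C ∧ ∃ m₀ : ℕ, ∀ m : ℕ, m₀ ≤ m → a m ≤ ENNReal.ofReal (C * b m)

/-- Dyadic block `I_0 = {0}`, `I_n = {k : 2^{n-1} ≤ |k| < 2^n}` for `n ≥ 1`. -/
def blockF (n : ℕ) : Finset ℤ :=
  (Finset.Icc (-(2^n : ℤ)) (2^n)).filter fun k =>
    (n = 0 ∧ k = 0) ∨ (n ≠ 0 ∧ 2^(n-1) ≤ |k| ∧ |k| < 2^n)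

/-- The dyadic block projection `∑_{k ∈ I_j} f̂(k) e^{2π i k·x}`. -/
def blockProj (d : ℕ) (f : (Fin d → ℝ) → ℂ) (j : Fin d → ℕ) : (Fin d → ℝ) → ℂ :=
  fun x => ∑ k ∈ Fintype.piFinset (fun i => blockF (j i)), fCoeff d f k * expk d k x

/-- The mixed-smoothness Besov (quasi-)norm `‖f‖_{S^s_{p,θ}B}`
(with the sup modification for `θ = ∞`). -/
def besovNorm (d : ℕ) (s : ℝ) (p θ : ℝ≥0∞) (f : (Fin d → ℝ) → ℂ) : ℝ≥0∞ :=
  if θ = ∞ then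
    ⨆ j : Fin d → ℕ,
      ENNReal.ofReal ((2:ℝ) ^ (((∑ i, j i : ℕ) : ℝ) * s)) * LqNorm d p (blockProj d f j)
  else
    (∑' j : Fin d → ℕ,
      (ENNReal.ofReal ((2:ℝ) ^ (((∑ i, j i : ℕ) : ℝ) * s)) * LqNorm d p (blockProj d f j))
        ^ θ.toReal) ^ (1 / θ.toReal)

/-- The mixed-smoothness Sobolev norm `‖f‖_{S^s_p W}` (Littlewood–Paley form),
with `S^0_p W := L_p`. -/
def sobolevNorm (d : ℕ) (s : ℝ) (p : ℝ≥0∞) (f : (Fin d → ℝ) → ℂ) : ℝ≥0∞ :=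
  if s = 0 then LqNorm d p f
  else
    (∫⁻ x in cube d,
      ((∑' j : Fin d → ℕ,
        (ENNReal.ofReal ((2:ℝ) ^ (((∑ i, j i : ℕ) : ℝ) * s)) *
          (‖blockProj d f j x‖₊ : ℝ≥0∞)) ^ (2:ℕ)) ^ ((1:ℝ)/2)) ^ p.toReal) ^ (1 / p.toReal)

/-- Trigonometric polynomials with frequencies in `[-M,M]^d`. -/
def boxPoly (d M : ℕ) : Set ((Fin d → ℝ) → ℂ) :=
  {s | ∃ (Λ : Finset (Fin d → ℤ)) (a : (Fin d → ℤ) → ℂ),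
    (∀ k ∈ Λ, ∀ i, |k i| ≤ (M : ℤ)) ∧ s = fun x => ∑ k ∈ Λ, a k * expk d k x}

/-- Error of best approximation by trigonometric polynomials with
frequencies in `[-M,M]^d`, measured in `L_∞`. -/
def EBox (d M : ℕ) (f : (Fin d → ℝ) → ℂ) : ℝ≥0∞ :=
  ⨅ g ∈ boxPoly d M, LqNorm d ∞ (f - g)

/-- The `m`-th (non-linear) sampling width of the class of continuous functions
in the unit ball of `N`, error measured in `L_q`. -/
def samplingWidth (d m : ℕ) (N : ((Fin d → ℝ) → ℂ) → ℝ≥0∞) (q : ℝ≥0∞) : ℝ≥0∞ :=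
  ⨅ (t : Fin m → (Fin d → ℝ)) (_ : ∀ i, t i ∈ cube d)
    (R : (Fin m → ℂ) → ((Fin d → ℝ) → ℂ)),
    ⨆ f ∈ {f : (Fin d → ℝ) → ℂ | Continuous f ∧ N f ≤ 1},
      LqNorm d q (f - R fun i => f (t i))


section Characters

variable {d : ℕ}

lemma expk_eq_prod (k : Fin d → ℤ) (x : Fin d → ℝ) :
    expk d k x = ∏ i, Complex.exp (2 * π * Complex.I * (k i : ℂ) * (x i : ℂ)) := by
  rw [expk, ← Complex.exp_sum]
  congr 1
  push_cast
  rw [Finset.mul_sum, Finset.sum_mul]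
  exact Finset.sum_congr rfl fun i _ => by ring

lemma expk_add (k l : Fin d → ℤ) (x : Fin d → ℝ) :
    expk d (k + l) x = expk d k x * expk d l x := by
  simp only [expk_eq_prod, ← Finset.prod_mul_distrib, ← Complex.exp_add]
  refine Finset.prod_congr rfl fun i _ => ?_
  congr 1
  simp only [Pi.add_apply]
  push_cast
  ring

lemma norm_expk (k : Fin d → ℤ) (x : Fin d → ℝ) : ‖expk d k x‖ = 1 :=
  Complex.norm_exp_ofReal_mul_I _

lemma conj_expk (k : Fin d → ℤ) (x : Fin d → ℝ) :
    (starRingEnd ℂ) (expk d k x) = expk d (-k) x := by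
  rw [expk, expk, ← Complex.exp_conj]
  rw [map_mul, Complex.conj_ofReal, Complex.conj_I]
  simp

lemma continuous_expk (k : Fin d → ℤ) : Continuous (expk d k) := by
  unfold expk
  fun_prop

instance isProbabilityMeasure_restrict_cube :
    IsProbabilityMeasure ((volume : Measure (Fin d → ℝ)).restrict (cube d)) := by
  constructor
  rw [Measure.restrict_apply_univ, cube, volume_pi_pi]
  simp

lemma integral_cexp_Ico (n : ℤ) :
    ∫ x in Set.Ico (0 : ℝ) 1, Complex.exp (2 * π * Complex.I * (n : ℂ) * (x : ℂ)) =
      if n = 0 then 1 else 0 := by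
  rw [integral_Ico_eq_integral_Ioc, ← intervalIntegral.integral_of_le zero_le_one]
  split_ifs with h
  · simp [h]
  · have hc : (2 * π * Complex.I * (n : ℂ)) ≠ 0 := by
      simp [h, Real.pi_ne_zero, Complex.I_ne_zero]
    rw [integral_exp_mul_complex hc]
    have : Complex.exp (2 * π * Complex.I * (n : ℂ)) = 1 := by
      rw [mul_comm]
      exact Complex.exp_int_mul_two_pi_mul_I n
    simp [this]

lemma integral_expk (k : Fin d → ℤ) :
    ∫ x in cube d, expk d k x = if k = 0 then 1 else 0 := by
  simp only [expk_eq_prod]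
  rw [cube, volume_pi, Measure.restrict_pi_pi,
    integral_fintype_prod_eq_prod
      (f := fun i (t : ℝ) => Complex.exp (2 * π * Complex.I * (k i : ℂ) * (t : ℂ)))]
  simp only [integral_cexp_Ico]
  split_ifs with h
  · simp [h]
  · obtain ⟨i, hi⟩ := Function.ne_iff.mp h
    exact Finset.prod_eq_zero (Finset.mem_univ i) (if_neg hi)

lemma integrableOn_expk (k : Fin d → ℤ) : IntegrableOn (expk d k) (cube d) :=
  Integrable.of_bound (continuous_expk k).aestronglyMeasurable 1
    (Filter.Eventually.of_forall fun x => (norm_expk k x).le)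

lemma integrableOn_sum_expk (Λ : Finset (Fin d → ℤ)) (a : (Fin d → ℤ) → ℂ) :
    IntegrableOn (fun x => ∑ k ∈ Λ, a k * expk d k x) (cube d) :=
  integrable_finsetSum _ fun k _ => (integrableOn_expk k).const_mul (a k)

lemma continuous_sum_expk (Λ : Finset (Fin d → ℤ)) (a : (Fin d → ℤ) → ℂ) :
    Continuous fun x => ∑ k ∈ Λ, a k * expk d k x :=
  continuous_finsetSum _ fun k _ => continuous_const.mul (continuous_expk k)

lemma fCoeff_sum_expk (Λ : Finset (Fin d → ℤ)) (a : (Fin d → ℤ) → ℂ) (l : Fin d → ℤ) :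
    fCoeff d (fun x => ∑ k ∈ Λ, a k * expk d k x) l = if l ∈ Λ then a l else 0 := by
  have h : ∀ x, (∑ k ∈ Λ, a k * expk d k x) * expk d (-l) x =
      ∑ k ∈ Λ, a k * expk d (k + -l) x := fun x => by
    rw [Finset.sum_mul]
    exact Finset.sum_congr rfl fun k _ => by rw [expk_add, mul_assoc]
  simp only [fCoeff, h]
  rw [integral_finsetSum _ fun k _ => (integrableOn_expk (k + -l)).const_mul (a k)]
  simp only [integral_const_mul, integral_expk, add_neg_eq_zero, mul_ite, mul_one, mul_zero]
  simp

lemma fCoeff_sub {f g : (Fin d → ℝ) → ℂ} (hf : IntegrableOn f (cube d))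
    (hg : IntegrableOn g (cube d)) (k : Fin d → ℤ) :
    fCoeff d (f - g) k = fCoeff d f k - fCoeff d g k := by
  have hint : ∀ {u : (Fin d → ℝ) → ℂ}, IntegrableOn u (cube d) →
      IntegrableOn (fun x => u x * expk d (-k) x) (cube d) := fun hu =>
    Integrable.mul_bdd (c := 1) hu (continuous_expk _).aestronglyMeasurable
      (Filter.Eventually.of_forall fun x => (norm_expk _ x).le)
  simp only [fCoeff, Pi.sub_apply, sub_mul]
  exact integral_sub (hint hf) (hint hg)

/-- Parseval's identity for trigonometric polynomials. -/
lemma lintegral_sum_expk_sq (Λ : Finset (Fin d → ℤ)) (a : (Fin d → ℤ) → ℂ) :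
    ∫⁻ x in cube d, ‖∑ k ∈ Λ, a k * expk d k x‖ₑ ^ 2 = ∑ k ∈ Λ, ‖a k‖ₑ ^ 2 := by
  set g : (Fin d → ℝ) → ℂ := fun x => ∑ k ∈ Λ, a k * expk d k x with hg
  have hgc : Continuous g := continuous_sum_expk Λ a
  have hgb : ∀ x, ‖g x‖ ≤ ∑ k ∈ Λ, ‖a k‖ := fun x =>
    (norm_sum_le _ _).trans (Finset.sum_le_sum fun k _ => by rw [norm_mul, norm_expk, mul_one])
  have hint : IntegrableOn (fun x => ‖g x‖ ^ 2) (cube d) :=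
    Integrable.of_bound (hgc.norm.pow 2).aestronglyMeasurable ((∑ k ∈ Λ, ‖a k‖) ^ 2)
      (Filter.Eventually.of_forall fun x => by
        rw [Real.norm_of_nonneg (by positivity)]
        exact pow_le_pow_left₀ (norm_nonneg _) (hgb x) 2)
  have hint' : ∀ k, IntegrableOn (fun x => g x * expk d (-k) x) (cube d) := fun k =>
    Integrable.mul_bdd (c := 1) (integrableOn_sum_expk Λ a)
      (continuous_expk _).aestronglyMeasurable
      (Filter.Eventually.of_forall fun x => (norm_expk _ x).le)
  have hsq : ∀ x, ((‖g x‖ ^ 2 : ℝ) : ℂ) =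
      ∑ k ∈ Λ, (starRingEnd ℂ) (a k) * (g x * expk d (-k) x) := fun x => by
    rw [Complex.ofReal_pow, ← Complex.mul_conj']
    conv_lhs => rw [hg]
    simp only [map_sum, map_mul, conj_expk, Finset.mul_sum]
    exact Finset.sum_congr rfl fun k _ => by ring
  have hC : ((∫ x in cube d, ‖g x‖ ^ 2 : ℝ) : ℂ) = ((∑ k ∈ Λ, ‖a k‖ ^ 2 : ℝ) : ℂ) := by
    rw [← integral_complex_ofReal]
    simp only [hsq]
    rw [integral_finsetSum _ fun k _ => (hint' k).const_mul _]
    simp only [integral_const_mul]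
    push_cast
    refine Finset.sum_congr rfl fun k hk => ?_
    have : ∫ x in cube d, g x * expk d (-k) x = a k := by
      have := fCoeff_sum_expk Λ a k
      rwa [if_pos hk] at this
    rw [this, Complex.conj_mul']
  have hR : ∫ x in cube d, ‖g x‖ ^ 2 = ∑ k ∈ Λ, ‖a k‖ ^ 2 := by exact_mod_cast hC
  have e : ∀ z : ℂ, ‖z‖ₑ ^ 2 = ENNReal.ofReal (‖z‖ ^ 2) := fun z => by
    rw [ENNReal.ofReal_pow (norm_nonneg _), ofReal_norm]
  simp only [e]
  rw [← ofReal_integral_eq_lintegral_ofReal hint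
      (Filter.Eventually.of_forall fun x => by positivity), hR,
    ENNReal.ofReal_sum_of_nonneg fun k _ => by positivity]

end Characters

section Nikolskii

variable {d : ℕ}

/-- Nikolskii's inequality between `L_p` and `L_2`, `p ≤ 2`, with the `L_2`-norm expressed through
the coefficients. -/
lemma sum_enorm_sq_le_lintegral_rpow {Λ : Finset (Fin d → ℤ)} (a : (Fin d → ℤ) → ℂ) {P : ℝ}
    (hP1 : 1 < P) (hP2 : P ≤ 2) :
    (∑ k ∈ Λ, ‖a k‖ₑ ^ 2) ^ (1 / 2 : ℝ) ≤ (Λ.card : ℝ≥0∞) ^ (1 / P - 1 / 2) *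
      (∫⁻ x in cube d, ‖∑ k ∈ Λ, a k * expk d k x‖ₑ ^ P) ^ (1 / P) := by
  have hP0 : 0 < P := by linarith
  set S : ℝ≥0∞ := ∑ k ∈ Λ, ‖a k‖ₑ ^ 2 with hS
  set I : ℝ≥0∞ := ∫⁻ x in cube d, ‖∑ k ∈ Λ, a k * expk d k x‖ₑ ^ P with hI
  have hSfin : S ≠ ∞ := by
    rw [hS]
    exact ENNReal.sum_ne_top.2 fun k _ => ENNReal.pow_ne_top enorm_ne_top
  rcases eq_or_ne S 0 with h0 | h0
  · rw [h0, ENNReal.zero_rpow_of_pos (by norm_num)]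
    exact zero_le
  have hsup : ∀ x, ‖∑ k ∈ Λ, a k * expk d k x‖ₑ ≤ ((Λ.card : ℝ≥0∞) * S) ^ (1 / 2 : ℝ) := by
    intro x
    have h1 : ‖∑ k ∈ Λ, a k * expk d k x‖ₑ ≤ ∑ k ∈ Λ, ‖a k‖ₑ := by
      refine (enorm_sum_le _ _).trans (Finset.sum_le_sum fun k _ => ?_)
      rw [enorm_mul, ← ofReal_norm (expk d k x), norm_expk, ENNReal.ofReal_one, mul_one]
    have h2 : (∑ k ∈ Λ, ‖a k‖ₑ) ^ (2 : ℝ) ≤ (Λ.card : ℝ≥0∞) * S := by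
      have := ENNReal.rpow_sum_le_const_mul_sum_rpow Λ (fun k => ‖a k‖ₑ) (p := 2) (by norm_num)
      simp only [ENNReal.rpow_two] at this ⊢
      rw [show (2 : ℝ) - 1 = 1 by norm_num, ENNReal.rpow_one] at this
      exact this
    refine h1.trans ?_
    rw [← ENNReal.rpow_le_rpow_iff (z := 2) (by norm_num), ← ENNReal.rpow_mul]
    simpa using h2
  have hmain : S ≤ ((Λ.card : ℝ≥0∞) * S) ^ ((2 - P) / 2) * I := by
    rw [hI, ← lintegral_const_mul' _ _ (ENNReal.rpow_ne_top_of_nonneg (by linarith)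
      (ENNReal.mul_ne_top (ENNReal.natCast_ne_top _) hSfin))]
    refine (lintegral_sum_expk_sq Λ a).symm.trans_le ?_
    refine lintegral_mono fun x => ?_
    have : ‖∑ k ∈ Λ, a k * expk d k x‖ₑ ^ 2 =
        ‖∑ k ∈ Λ, a k * expk d k x‖ₑ ^ (2 - P) * ‖∑ k ∈ Λ, a k * expk d k x‖ₑ ^ P := by
      rw [← ENNReal.rpow_add_of_nonneg _ _ (by linarith) hP0.le, sub_add_cancel, ENNReal.rpow_two]
    rw [this]
    refine mul_le_mul_left ?_ _
    refine (ENNReal.rpow_le_rpow (hsup x) (by linarith)).trans_eq ?_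
    rw [← ENNReal.rpow_mul]
    congr 1
    ring
  have hSP : S ^ (P / 2) ≤ (Λ.card : ℝ≥0∞) ^ ((2 - P) / 2) * I := by
    rw [ENNReal.mul_rpow_of_nonneg _ _ (by linarith)] at hmain
    have hd : S ^ ((2 - P) / 2) ≠ 0 := by simp [ENNReal.rpow_eq_zero_iff, h0, hSfin]
    have hd' : S ^ ((2 - P) / 2) ≠ ∞ := ENNReal.rpow_ne_top_of_nonneg (by linarith) hSfin
    refine (ENNReal.mul_le_mul_iff_right hd hd').1 ?_
    calc S ^ ((2 - P) / 2) * S ^ (P / 2) = S := by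
          rw [← ENNReal.rpow_add _ _ h0 hSfin, show (2 - P) / 2 + P / 2 = 1 by ring,
            ENNReal.rpow_one]
      _ ≤ _ := hmain
      _ = _ := by ring
  calc S ^ (1 / 2 : ℝ) = (S ^ (P / 2)) ^ (1 / P) := by
        rw [← ENNReal.rpow_mul]; congr 1; field_simp
    _ ≤ ((Λ.card : ℝ≥0∞) ^ ((2 - P) / 2) * I) ^ (1 / P) :=
        ENNReal.rpow_le_rpow hSP (by positivity)
    _ = _ := by
        rw [ENNReal.mul_rpow_of_nonneg _ _ (by positivity), ← ENNReal.rpow_mul]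
        congr 2
        field_simp

/-- The `ℓ_T`-norm of the coefficients of a trigonometric polynomial with at most `N` terms is
controlled by its `L_P`-norm. -/
lemma sum_enorm_rpow_le {Λ : Finset (Fin d → ℤ)} {N : ℕ} (hN : Λ.card ≤ N)
    (a : (Fin d → ℤ) → ℂ) {P T : ℝ} (hP1 : 1 < P) (hP2 : P ≤ 2) (hT0 : 0 < T) (hT2 : T ≤ 2) :
    ∑ k ∈ Λ, ‖a k‖ₑ ^ T ≤ ((N : ℝ≥0∞) ^ (1 / P + 1 / T - 1) *
      (∫⁻ x in cube d, ‖∑ k ∈ Λ, a k * expk d k x‖ₑ ^ P) ^ (1 / P)) ^ T := by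
  have hP0 : 0 < P := by linarith
  have hT : 1 / 2 ≤ 1 / T := one_div_le_one_div_of_le hT0 hT2
  have hP : 1 / 2 ≤ 1 / P := one_div_le_one_div_of_le hP0 hP2
  set S : ℝ≥0∞ := ∑ k ∈ Λ, ‖a k‖ₑ ^ 2 with hS
  set I : ℝ≥0∞ := ∫⁻ x in cube d, ‖∑ k ∈ Λ, a k * expk d k x‖ₑ ^ P with hI
  have h1 : (∑ k ∈ Λ, ‖a k‖ₑ ^ T) ^ (2 / T) ≤ (Λ.card : ℝ≥0∞) ^ (2 / T - 1) * S := by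
    have := ENNReal.rpow_sum_le_const_mul_sum_rpow Λ (fun k => ‖a k‖ₑ ^ T) (p := 2 / T)
      ((one_le_div hT0).2 hT2)
    simp only [← ENNReal.rpow_mul, mul_div_cancel₀ _ hT0.ne', ENNReal.rpow_two] at this
    exact this
  have h2 : (∑ k ∈ Λ, ‖a k‖ₑ ^ T) ^ (1 / T) ≤
      (N : ℝ≥0∞) ^ (1 / P + 1 / T - 1) * I ^ (1 / P) := by
    calc (∑ k ∈ Λ, ‖a k‖ₑ ^ T) ^ (1 / T) = ((∑ k ∈ Λ, ‖a k‖ₑ ^ T) ^ (2 / T)) ^ (1 / 2 : ℝ) := by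
          rw [← ENNReal.rpow_mul]; congr 1; ring
      _ ≤ ((Λ.card : ℝ≥0∞) ^ (2 / T - 1) * S) ^ (1 / 2 : ℝ) :=
          ENNReal.rpow_le_rpow h1 (by norm_num)
      _ = (Λ.card : ℝ≥0∞) ^ (1 / T - 1 / 2) * S ^ (1 / 2 : ℝ) := by
          rw [ENNReal.mul_rpow_of_nonneg _ _ (by norm_num), ← ENNReal.rpow_mul]
          congr 2
          ring
      _ ≤ (Λ.card : ℝ≥0∞) ^ (1 / T - 1 / 2) *
            ((Λ.card : ℝ≥0∞) ^ (1 / P - 1 / 2) * I ^ (1 / P)) :=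
          mul_le_mul_right (sum_enorm_sq_le_lintegral_rpow a hP1 hP2) _
      _ = (Λ.card : ℝ≥0∞) ^ (1 / P + 1 / T - 1) * I ^ (1 / P) := by
          rw [← mul_assoc, ← ENNReal.rpow_add_of_nonneg _ _ (by linarith) (by linarith)]
          congr 2
          ring
      _ ≤ _ := mul_le_mul_left (ENNReal.rpow_le_rpow (by exact_mod_cast hN) (by linarith)) _
  rw [← ENNReal.rpow_le_rpow_iff (z := 1 / T) (by positivity), ← ENNReal.rpow_mul,
    mul_one_div_cancel hT0.ne', ENNReal.rpow_one]
  exact h2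

end Nikolskii

section Blocks

lemma mem_blockF {n : ℕ} {z : ℤ} :
    z ∈ blockF n ↔ (n = 0 ∧ z = 0) ∨ (n ≠ 0 ∧ 2 ^ (n - 1) ≤ |z| ∧ |z| < 2 ^ n) := by
  simp only [blockF, Finset.mem_filter, Finset.mem_Icc, and_iff_right_iff_imp]
  rintro (⟨rfl, rfl⟩ | ⟨_, _, h⟩)
  · simp
  · exact abs_le.1 h.le

lemma exists_mem_blockF (z : ℤ) : ∃ n, z ∈ blockF n := by
  rcases eq_or_ne z 0 with rfl | hz
  · exact ⟨0, mem_blockF.2 (Or.inl ⟨rfl, rfl⟩)⟩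
  · refine ⟨Nat.log 2 z.natAbs + 1, mem_blockF.2 (Or.inr ⟨by simp, ?_, ?_⟩)⟩
    · have := Nat.pow_log_le_self 2 (Int.natAbs_ne_zero.2 hz)
      rw [Int.abs_eq_natAbs]
      exact_mod_cast this
    · have := Nat.lt_pow_succ_log_self one_lt_two z.natAbs
      rw [Int.abs_eq_natAbs]
      exact_mod_cast this

lemma blockF_unique {n n' : ℕ} {z : ℤ} (h : z ∈ blockF n) (h' : z ∈ blockF n') : n = n' := by
  have key : ∀ {a b : ℕ}, z ∈ blockF a → z ∈ blockF b → ¬ a < b := by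
    intro a b ha hb hab
    have hz : |z| < 2 ^ a := by
      rcases mem_blockF.1 ha with ⟨rfl, rfl⟩ | ⟨_, _, h⟩
      · simp
      · exact h
    rcases mem_blockF.1 hb with ⟨rfl, _⟩ | ⟨_, h1, _⟩
    · omega
    · have : (2 : ℤ) ^ a ≤ 2 ^ (b - 1) := pow_le_pow_right₀ (by norm_num) (by omega)
      omega
  have := key h h'
  have := key h' h
  omega

lemma card_blockF_le (n : ℕ) : (blockF n).card ≤ 2 ^ n := by
  rcases n with _ | n
  · have : blockF 0 ⊆ {0} := fun z hz => by
      rcases mem_blockF.1 hz with ⟨_, rfl⟩ | ⟨h, _⟩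
      · simp
      · exact absurd rfl h
    simpa using Finset.card_le_card this
  · have hsub : blockF (n + 1) ⊆
        Finset.Ico ((2 : ℤ) ^ n) (2 ^ (n + 1)) ∪ Finset.Ioc (-2 ^ (n + 1)) (-2 ^ n) := by
      intro z hz
      rcases mem_blockF.1 hz with ⟨h, _⟩ | ⟨_, h1, h2⟩
      · omega
      · simp only [Nat.add_sub_cancel] at h1
        simp only [Finset.mem_union, Finset.mem_Ico, Finset.mem_Ioc]
        rcases abs_cases z with ⟨h, _⟩ | ⟨h, _⟩ <;> omega
    refine (Finset.card_le_card hsub).trans ((Finset.card_union_le _ _).trans ?_)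
    rw [Int.card_Ico, Int.card_Ioc]
    have h1 : (2 : ℤ) ^ (n + 1) - 2 ^ n = ((2 ^ n : ℕ) : ℤ) := by push_cast; ring
    have h2 : -(2 : ℤ) ^ n - -2 ^ (n + 1) = ((2 ^ n : ℕ) : ℤ) := by push_cast; ring
    rw [h1, h2, Int.toNat_natCast, pow_succ]
    omega

variable {d : ℕ}

/-- The dyadic block `I_j = I_{j_1} × ⋯ × I_{j_d}`. -/
def block (j : Fin d → ℕ) : Finset (Fin d → ℤ) := Fintype.piFinset fun i => blockF (j i)

lemma exists_mem_block (k : Fin d → ℤ) : ∃ j, k ∈ block j := by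
  choose j hj using fun i => exists_mem_blockF (k i)
  exact ⟨j, Fintype.mem_piFinset.2 hj⟩

lemma block_unique {j j' : Fin d → ℕ} {k : Fin d → ℤ} (h : k ∈ block j) (h' : k ∈ block j') :
    j = j' :=
  funext fun i => blockF_unique (Fintype.mem_piFinset.1 h i) (Fintype.mem_piFinset.1 h' i)

lemma card_block_le (j : Fin d → ℕ) : (block j).card ≤ 2 ^ ∑ i, j i := by
  rw [block, Fintype.card_piFinset, ← Finset.prod_pow_eq_pow_sum]
  exact Finset.prod_le_prod' fun i _ => card_blockF_le (j i)

/-- The multi-indices `j` with `‖j‖₁ < n`. -/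
def lowIndices (d n : ℕ) : Finset (Fin d → ℕ) :=
  (Fintype.piFinset fun _ => Finset.range n).filter fun j => ∑ i, j i < n

lemma mem_lowIndices {n : ℕ} {j : Fin d → ℕ} : j ∈ lowIndices d n ↔ ∑ i, j i < n := by
  simp only [lowIndices, Finset.mem_filter, Fintype.mem_piFinset, Finset.mem_range,
    and_iff_right_iff_imp]
  exact fun h i => (Finset.single_le_sum (fun _ _ => Nat.zero_le _) (Finset.mem_univ i)).trans_lt h

/-- The dyadic hyperbolic cross, the union of the blocks `I_j` with `‖j‖₁ < n`. -/
def hyperbolicCross (d n : ℕ) : Finset (Fin d → ℤ) := (lowIndices d n).biUnion block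

lemma card_hyperbolicCross_le (hd : 1 ≤ d) (n : ℕ) :
    (hyperbolicCross d n).card ≤ n ^ (d - 1) * 2 ^ n := by
  obtain ⟨e, rfl⟩ : ∃ e, d = e + 1 := ⟨d - 1, by omega⟩
  have hfib : ∀ l ∈ Finset.range n,
      ((lowIndices (e + 1) n).filter fun j => ∑ i, j i = l).card ≤ n ^ e := by
    intro l _
    have : (Fintype.piFinset fun _ : Fin e => Finset.range n).card = n ^ e := by
      simp [Fintype.card_piFinset]
    rw [← this]
    refine Finset.card_le_card_of_injOn (fun j => Fin.init j) ?_ ?_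
    · intro j hj
      have hj' := (Finset.mem_filter.1 (Finset.mem_filter.1 hj).1).1
      exact Fintype.mem_piFinset.2 fun i => Fintype.mem_piFinset.1 hj' i.castSucc
    · intro j hj j' hj' h
      have h1 := (Finset.mem_filter.1 hj).2
      have h2 := (Finset.mem_filter.1 hj').2
      rw [Fin.sum_univ_castSucc] at h1 h2
      have hi : ∀ i : Fin e, j i.castSucc = j' i.castSucc := fun i => congrFun h i
      have hlast : j (Fin.last e) = j' (Fin.last e) := by
        simp only [hi] at h1
        omega
      exact funext fun i => Fin.lastCases hlast hi i
  calc (hyperbolicCross (e + 1) n).card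
      ≤ ∑ j ∈ lowIndices (e + 1) n, (block j).card := Finset.card_biUnion_le
    _ ≤ ∑ j ∈ lowIndices (e + 1) n, 2 ^ ∑ i, j i := Finset.sum_le_sum fun j _ => card_block_le j
    _ = ∑ l ∈ Finset.range n, ∑ j ∈ lowIndices (e + 1) n with ∑ i, j i = l, 2 ^ ∑ i, j i :=
        (Finset.sum_fiberwise_of_maps_to
          (fun j hj => Finset.mem_range.2 (mem_lowIndices.1 hj)) _).symm
    _ = ∑ l ∈ Finset.range n,
          ((lowIndices (e + 1) n).filter fun j => ∑ i, j i = l).card * 2 ^ l := by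
        refine Finset.sum_congr rfl fun l _ => ?_
        rw [Finset.sum_congr rfl fun j hj => by rw [(Finset.mem_filter.1 hj).2],
          Finset.sum_const, smul_eq_mul]
    _ ≤ ∑ l ∈ Finset.range n, n ^ e * 2 ^ l :=
        Finset.sum_le_sum fun l hl => Nat.mul_le_mul_right _ (hfib l hl)
    _ ≤ n ^ (e + 1 - 1) * 2 ^ n := by
        rw [← Finset.mul_sum, Nat.add_sub_cancel]
        refine Nat.mul_le_mul_left _ ?_
        have := Nat.geomSum_lt (n := n) (s := Finset.range n) (le_refl 2)
          fun k hk => Finset.mem_range.1 hk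
        exact this.le

end Blocks

section UpperBound

variable {d : ℕ}

lemma LqNorm_eq_lintegral {p : ℝ≥0∞} (hp0 : p ≠ 0) (hp : p ≠ ∞) (g : (Fin d → ℝ) → ℂ) :
    LqNorm d p g = (∫⁻ x in cube d, ‖g x‖ₑ ^ p.toReal) ^ (1 / p.toReal) :=
  eLpNorm_eq_lintegral_rpow_enorm_toReal hp0 hp

lemma wienerNorm_zero (η : ℝ≥0∞) (f : (Fin d → ℝ) → ℂ) :
    wienerNorm d 0 η f = if η = ∞ then ⨆ k, ‖fCoeff d f k‖ₑ
      else (∑' k, ‖fCoeff d f k‖ₑ ^ η.toReal) ^ (1 / η.toReal) := by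
  simp [wienerNorm, enorm_eq_nnnorm]

lemma ofReal_two_rpow (x : ℝ) : ENNReal.ofReal ((2 : ℝ) ^ x) = (2 : ℝ≥0∞) ^ x := by
  rw [← ENNReal.ofReal_rpow_of_pos two_pos, ENNReal.ofReal_ofNat]

/-- On the unit ball of `S^r_{p,θ}B` the coefficients outside the hyperbolic cross are small
in `ℓ_θ`. -/
lemma tsum_compl_hyperbolicCross_le {p θ : ℝ≥0∞} (hp1 : 1 < p) (hp2 : p ≤ 2)
    (hθ : 0 < θ) (hθ2 : θ ≤ 2) {r : ℝ} (hr : 1 / p.toReal + 1 / θ.toReal - 1 < r)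
    {f : (Fin d → ℝ) → ℂ} (hf : besovNorm d r p θ f ≤ 1) (n : ℕ) :
    ∑' k, (if k ∈ hyperbolicCross d n then 0 else ‖fCoeff d f k‖ₑ ^ θ.toReal) ≤
      ((2 : ℝ≥0∞) ^ (-((r + 1 - 1 / p.toReal - 1 / θ.toReal) * n))) ^ θ.toReal := by
  have hptop : p ≠ ∞ := ne_top_of_le_ne_top (by norm_num) hp2
  have hθtop : θ ≠ ∞ := ne_top_of_le_ne_top (by norm_num) hθ2
  have hp0 : p ≠ 0 := (zero_lt_one.trans hp1).ne'
  set P := p.toReal with hP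
  set T := θ.toReal with hT
  have hP1 : 1 < P := by
    have := (ENNReal.toReal_lt_toReal (by norm_num) hptop).2 hp1
    simpa using this
  have hP2 : P ≤ 2 := by
    have := (ENNReal.toReal_le_toReal hptop (by norm_num)).2 hp2
    simpa using this
  have hT0 : 0 < T := ENNReal.toReal_pos hθ.ne' hθtop
  have hT2 : T ≤ 2 := by
    have := (ENNReal.toReal_le_toReal hθtop (by norm_num)).2 hθ2
    simpa using this
  set s := r + 1 - 1 / P - 1 / T with hs
  have hs0 : 0 < s := by rw [hs]; linarith
  have hf' : ∑' j : Fin d → ℕ, ((2 : ℝ≥0∞) ^ (((∑ i, j i : ℕ) : ℝ) * r) *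
      LqNorm d p (blockProj d f j)) ^ T ≤ 1 := by
    rw [besovNorm, if_neg hθtop] at hf
    simp only [ofReal_two_rpow] at hf
    have := ENNReal.rpow_le_rpow hf hT0.le
    rwa [← ENNReal.rpow_mul, one_div_mul_cancel hT0.ne', ENNReal.rpow_one,
      ENNReal.one_rpow] at this
  have hblock : ∀ j : Fin d → ℕ,
      ∑ k ∈ block j, (if k ∈ hyperbolicCross d n then 0 else ‖fCoeff d f k‖ₑ ^ T) ≤
      ((2 : ℝ≥0∞) ^ (-(s * n))) ^ T * ((2 : ℝ≥0∞) ^ (((∑ i, j i : ℕ) : ℝ) * r) *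
      LqNorm d p (blockProj d f j)) ^ T := by
    intro j
    by_cases hj : ∑ i, j i < n
    · refine (Finset.sum_eq_zero fun k hk => ?_).trans_le zero_le
      exact if_pos (Finset.mem_biUnion.2 ⟨j, mem_lowIndices.2 hj, hk⟩)
    · refine (Finset.sum_le_sum (g := fun k => ‖fCoeff d f k‖ₑ ^ T) fun k _ => ?_).trans ?_
      · split_ifs
        · exact zero_le
        · exact le_rfl
      refine (sum_enorm_rpow_le (card_block_le j) (fCoeff d f) hP1 hP2 hT0 hT2).trans ?_
      rw [← ENNReal.mul_rpow_of_nonneg _ _ hT0.le, ← mul_assoc, LqNorm_eq_lintegral hp0 hptop,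
        ← ENNReal.rpow_add _ _ (by norm_num) (by norm_num)]
      refine ENNReal.rpow_le_rpow (mul_le_mul_left ?_ _) hT0.le
      rw [Nat.cast_pow, ← ENNReal.rpow_natCast, ← ENNReal.rpow_mul, Nat.cast_ofNat]
      refine ENNReal.rpow_le_rpow_of_exponent_le (by norm_num) ?_
      have : (n : ℝ) ≤ ((∑ i, j i : ℕ) : ℝ) := by exact_mod_cast not_lt.1 hj
      have := mul_le_mul_of_nonneg_left this hs0.le
      have e : ((∑ i, j i : ℕ) : ℝ) * (1 / P + 1 / T - 1) =
        ((∑ i, j i : ℕ) : ℝ) * r - s * ((∑ i, j i : ℕ) : ℝ) := by rw [hs]; ring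
      rw [e]
      linarith
  calc ∑' k, (if k ∈ hyperbolicCross d n then 0 else ‖fCoeff d f k‖ₑ ^ T)
      ≤ ∑' (k : Fin d → ℤ) (j : Fin d → ℕ), (if k ∈ block j then
          (if k ∈ hyperbolicCross d n then 0 else ‖fCoeff d f k‖ₑ ^ T) else 0) := by
        refine ENNReal.tsum_le_tsum fun k => ?_
        obtain ⟨j, hj⟩ := exists_mem_block k
        refine le_trans ?_ (ENNReal.le_tsum j)
        rw [if_pos hj]
    _ = ∑' (j : Fin d → ℕ), ∑ k ∈ block j,
          (if k ∈ hyperbolicCross d n then 0 else ‖fCoeff d f k‖ₑ ^ T) := by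
        rw [ENNReal.tsum_comm]
        refine tsum_congr fun j => ?_
        rw [tsum_eq_sum (s := block j) fun k hk => if_neg hk]
        exact Finset.sum_congr rfl fun k hk => if_pos hk
    _ ≤ ∑' j : Fin d → ℕ, ((2 : ℝ≥0∞) ^ (-(s * n))) ^ T *
          ((2 : ℝ≥0∞) ^ (((∑ i, j i : ℕ) : ℝ) * r) * LqNorm d p (blockProj d f j)) ^ T :=
        ENNReal.tsum_le_tsum hblock
    _ ≤ _ := by
        rw [ENNReal.tsum_mul_left]
        exact mul_le_of_le_one_right' hf'

/-- A function whose coefficients are bounded by `ε M^{-1/θ}` and have `ℓ_θ`-norm at most `ε` has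
`A_η`-norm at most `ε M^{1/η - 1/θ}`. -/
lemma wienerNorm_le_of_coeff_le {θ η : ℝ≥0∞} (hθ : 0 < θ) (hθη : θ ≤ η)
    {g : (Fin d → ℝ) → ℂ} {ε M : ℝ≥0∞} (hε0 : ε ≠ 0) (hε : ε ≠ ∞)
    (hsup : ∀ k, ‖fCoeff d g k‖ₑ ≤ ε * M ^ (-(1 / θ.toReal)))
    (hsum : ∑' k, ‖fCoeff d g k‖ₑ ^ θ.toReal ≤ ε ^ θ.toReal) :
    wienerNorm d 0 η g ≤ ε * M ^ (1 / η.toReal - 1 / θ.toReal) := by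
  rw [wienerNorm_zero]
  split_ifs with hη
  · refine iSup_le fun k => (hsup k).trans_eq ?_
    simp [hη]
  · have hθtop : θ ≠ ∞ := ne_top_of_le_ne_top hη hθη
    set T := θ.toReal with hT
    set E := η.toReal with hE
    have hT0 : 0 < T := ENNReal.toReal_pos hθ.ne' hθtop
    have hTE : T ≤ E := (ENNReal.toReal_le_toReal hθtop hη).2 hθη
    have hE0 : 0 < E := hT0.trans_le hTE
    rw [← ENNReal.rpow_le_rpow_iff hE0, ← ENNReal.rpow_mul, one_div_mul_cancel hE0.ne',
      ENNReal.rpow_one]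
    calc ∑' k, ‖fCoeff d g k‖ₑ ^ E
        ≤ ∑' k, (ε * M ^ (-(1 / T))) ^ (E - T) * ‖fCoeff d g k‖ₑ ^ T := by
          refine ENNReal.tsum_le_tsum fun k => ?_
          calc ‖fCoeff d g k‖ₑ ^ E = ‖fCoeff d g k‖ₑ ^ (E - T) * ‖fCoeff d g k‖ₑ ^ T := by
                rw [← ENNReal.rpow_add_of_nonneg _ _ (by linarith) hT0.le, sub_add_cancel]
            _ ≤ _ := mul_le_mul_left (ENNReal.rpow_le_rpow (hsup k) (by linarith)) _
      _ ≤ (ε * M ^ (-(1 / T))) ^ (E - T) * ε ^ T := by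
          rw [ENNReal.tsum_mul_left]
          exact mul_le_mul_right hsum _
      _ = (ε * M ^ (1 / E - 1 / T)) ^ E := by
          rw [ENNReal.mul_rpow_of_nonneg _ _ (by linarith), ENNReal.mul_rpow_of_nonneg _ _ hE0.le,
            mul_right_comm, ← ENNReal.rpow_add _ _ hε0 hε, sub_add_cancel, ← ENNReal.rpow_mul,
            ← ENNReal.rpow_mul]
          congr 2
          field_simp
          ring

/-- Upper bound for best `m`-term approximation: take the hyperbolic cross and the largest
coefficients outside of it. -/
lemma sigmaF_le {p θ η : ℝ≥0∞} (hd : 1 ≤ d) (hp1 : 1 < p) (hp2 : p ≤ 2)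
    (hθ : 0 < θ) (hθ2 : θ ≤ 2) (hθη : θ ≤ η) {r : ℝ} (hr : 1 / p.toReal + 1 / θ.toReal - 1 < r)
    {f : (Fin d → ℝ) → ℂ} (hfi : IntegrableOn f (cube d)) (hf : besovNorm d r p θ f ≤ 1)
    {n m : ℕ} (hm : 0 < m) (hnm : 2 * (n ^ (d - 1) * 2 ^ n) ≤ m) :
    sigmaF d m (wienerNorm d 0 η) f ≤
      (2 : ℝ≥0∞) ^ (-((r + 1 - 1 / p.toReal - 1 / θ.toReal) * n)) *
        ((m : ℝ≥0∞) / 2) ^ (1 / η.toReal - 1 / θ.toReal) := by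
  have hθtop : θ ≠ ∞ := ne_top_of_le_ne_top (by norm_num) hθ2
  have htail := tsum_compl_hyperbolicCross_le hp1 hp2 hθ hθ2 hr hf n
  set T := θ.toReal with hT
  have hT0 : 0 < T := ENNReal.toReal_pos hθ.ne' hθtop
  set ε : ℝ≥0∞ := (2 : ℝ≥0∞) ^ (-((r + 1 - 1 / p.toReal - 1 / T) * n)) with hε
  have hε0 : ε ≠ 0 := by simp [hε, ENNReal.rpow_eq_zero_iff]
  have hεtop : ε ≠ ∞ := by simp [hε, ENNReal.rpow_eq_top_iff]
  set M : ℝ≥0∞ := (m : ℝ≥0∞) / 2 with hM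
  have hM0 : M ≠ 0 := by simp [hM, ENNReal.div_eq_zero_iff, hm.ne']
  have hMtop : M ≠ ∞ := by simp [hM, ENNReal.div_eq_top]
  set t : ℝ≥0∞ := ε * M ^ (-(1 / T)) with ht
  have ht_pow : t ^ T = ε ^ T / M := by
    rw [ht, ENNReal.mul_rpow_of_nonneg _ _ hT0.le, ← ENNReal.rpow_mul M, neg_mul,
      one_div_mul_cancel hT0.ne', ENNReal.rpow_neg_one, ENNReal.div_eq_inv_mul, mul_comm]
  have hεT0 : ε ^ T ≠ 0 := by simp [ENNReal.rpow_eq_zero_iff, hε0, hεtop]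
  have hεTtop : ε ^ T ≠ ∞ := ENNReal.rpow_ne_top_of_nonneg hT0.le hεtop
  have htT0 : t ^ T ≠ 0 := by
    rw [ht_pow]
    exact (ENNReal.div_pos hεT0 hMtop).ne'
  obtain ⟨hfin, hcard⟩ := ENNReal.finset_card_const_le_le_of_tsum_le hεTtop htail htT0
  have hdiv : ε ^ T / t ^ T = M := by
    rw [ht_pow, ENNReal.div_eq_inv_mul, ENNReal.inv_div (Or.inl hMtop) (Or.inl hM0),
      ENNReal.div_mul_cancel hεT0 hεTtop]
  rw [hdiv] at hcard
  set Λ : Finset (Fin d → ℤ) := hyperbolicCross d n ∪ hfin.toFinset with hΛ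
  have hΛcard : Λ.card ≤ m := by
    have h1 : ((hyperbolicCross d n).card : ℝ≥0∞) ≤ M := by
      rw [hM, ENNReal.le_div_iff_mul_le (by norm_num) (by norm_num)]
      have := card_hyperbolicCross_le hd n
      exact_mod_cast (by omega : (hyperbolicCross d n).card * 2 ≤ m)
    have h2 : (Λ.card : ℝ≥0∞) ≤ m := by
      calc (Λ.card : ℝ≥0∞) ≤ (hyperbolicCross d n).card + hfin.toFinset.card := by
            exact_mod_cast Finset.card_union_le _ _
        _ ≤ M + M := add_le_add h1 hcard
        _ = m := ENNReal.add_halves _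
    exact_mod_cast h2
  refine (iInf₂_le (fun x => ∑ k ∈ Λ, fCoeff d f k * expk d k x)
    ⟨Λ, fCoeff d f, hΛcard, rfl⟩).trans ?_
  have hcoeff : ∀ k, fCoeff d (f - fun x => ∑ k ∈ Λ, fCoeff d f k * expk d k x) k =
      if k ∈ Λ then 0 else fCoeff d f k := fun k => by
    rw [fCoeff_sub hfi (integrableOn_sum_expk _ _), fCoeff_sum_expk]
    split_ifs <;> simp
  refine wienerNorm_le_of_coeff_le hθ hθη hε0 hεtop (fun k => ?_) ?_
  · rw [hcoeff]
    split_ifs with hk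
    · simp
    · simp only [hΛ, Finset.mem_union, not_or, Set.Finite.mem_toFinset, Set.mem_ofPred_eq,
        not_le] at hk
      have := hk.2
      rw [if_neg hk.1, ENNReal.rpow_lt_rpow_iff hT0] at this
      exact this.le
  · refine (ENNReal.tsum_le_tsum fun k => ?_).trans htail
    rw [hcoeff]
    by_cases hk : k ∈ Λ
    · rw [if_pos hk, enorm_zero, ← hT, ENNReal.zero_rpow_of_pos hT0]
      exact zero_le
    · have : k ∉ hyperbolicCross d n := fun h => hk (Finset.mem_union_left _ h)
      rw [if_neg hk, if_neg this]

end UpperBound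

section LowerBound

variable {d : ℕ}

/-- A box of frequencies whose sumset is contained in the dyadic block `I_{b+2}`. -/
def halfBox (b : Fin d → ℕ) : Finset (Fin d → ℤ) :=
  Fintype.piFinset fun i => Finset.Ico ((2 : ℤ) ^ b i) (2 ^ (b i + 1))

lemma card_halfBox (b : Fin d → ℕ) : (halfBox b).card = 2 ^ ∑ i, b i := by
  rw [halfBox, Fintype.card_piFinset, ← Finset.prod_pow_eq_pow_sum]
  refine Finset.prod_congr rfl fun i _ => ?_
  rw [Int.card_Ico]
  have : (2 : ℤ) ^ (b i + 1) - 2 ^ b i = ((2 ^ b i : ℕ) : ℤ) := by push_cast; ring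
  rw [this, Int.toNat_natCast]

lemma add_mem_block {b : Fin d → ℕ} {k l : Fin d → ℤ} (hk : k ∈ halfBox b)
    (hl : l ∈ halfBox b) : k + l ∈ block fun i => b i + 2 := by
  refine Fintype.mem_piFinset.2 fun i => mem_blockF.2 (Or.inr ⟨Nat.succ_ne_zero _, ?_⟩)
  have h1 := Finset.mem_Ico.1 (Fintype.mem_piFinset.1 hk i)
  have h2 := Finset.mem_Ico.1 (Fintype.mem_piFinset.1 hl i)
  have e : b i + 2 - 1 = b i + 1 := by omega
  have h0 : (0 : ℤ) < 2 ^ b i := by positivity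
  have e1 : (2 : ℤ) ^ (b i + 1) = 2 * 2 ^ b i := by ring
  have e2 : (2 : ℤ) ^ (b i + 2) = 4 * 2 ^ b i := by ring
  rw [e, Pi.add_apply, abs_of_nonneg (by linarith [h1.1, h2.1])]
  constructor <;> linarith [h1.1, h1.2, h2.1, h2.2]

/-- The number of representations of `k` as a sum of two elements of `halfBox b`. -/
def repCount (b : Fin d → ℕ) (k : Fin d → ℤ) : ℕ :=
  ((halfBox b ×ˢ halfBox b).filter fun q => q.1 + q.2 = k).card

lemma repCount_eq_zero {b : Fin d → ℕ} {k : Fin d → ℤ} (hk : k ∉ block fun i => b i + 2) :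
    repCount b k = 0 := by
  refine Finset.card_eq_zero.2 (Finset.filter_eq_empty_iff.2 fun q hq h => hk ?_)
  rw [← h]
  exact add_mem_block (Finset.mem_product.1 hq).1 (Finset.mem_product.1 hq).2

lemma repCount_le (b : Fin d → ℕ) (k : Fin d → ℤ) : repCount b k ≤ 2 ^ ∑ i, b i := by
  rw [← card_halfBox]
  refine Finset.card_le_card_of_injOn Prod.fst (fun q hq => ?_) fun q hq q' hq' h => ?_
  · exact (Finset.mem_product.1 (Finset.mem_filter.1 hq).1).1
  · have h1 := (Finset.mem_filter.1 hq).2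
    have h2 := (Finset.mem_filter.1 hq').2
    refine Prod.ext h ?_
    rw [← h2, h] at h1
    exact add_left_cancel h1

lemma sum_repCount (b : Fin d → ℕ) :
    ∑ k ∈ block (fun i => b i + 2), repCount b k = (2 ^ ∑ i, b i) * 2 ^ ∑ i, b i := by
  rw [← card_halfBox, ← Finset.card_product]
  refine (Finset.card_eq_sum_card_fiberwise fun q hq => ?_).symm
  exact add_mem_block (Finset.mem_product.1 hq).1 (Finset.mem_product.1 hq).2

/-- The square of a Dirichlet-type kernel. -/
lemma sum_repCount_expk (b : Fin d → ℕ) (x : Fin d → ℝ) :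
    ∑ k ∈ block (fun i => b i + 2), (repCount b k : ℂ) * expk d k x =
      (∑ k ∈ halfBox b, 1 * expk d k x) ^ 2 := by
  simp only [one_mul]
  rw [sq, Finset.sum_mul_sum, ← Finset.sum_product',
    ← Finset.sum_fiberwise_of_maps_to (t := block fun i => b i + 2)
      (g := fun q : (Fin d → ℤ) × (Fin d → ℤ) => q.1 + q.2) fun q hq =>
        add_mem_block (Finset.mem_product.1 hq).1 (Finset.mem_product.1 hq).2]
  refine Finset.sum_congr rfl fun k _ => ?_
  rw [repCount, ← nsmul_eq_mul, ← Finset.sum_const]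
  refine Finset.sum_congr rfl fun q hq => ?_
  rw [← expk_add, (Finset.mem_filter.1 hq).2]

/-- At least half as many frequencies as `halfBox b` has are represented often. -/
lemma card_le_two_mul_card_filter_repCount (b : Fin d → ℕ) :
    2 ^ ∑ i, b i ≤ 2 * ((block fun i => b i + 2).filter fun k =>
      2 ^ ∑ i, b i ≤ 2 * 4 ^ d * repCount b k).card := by
  set N := 2 ^ ∑ i, b i with hN
  set Q := block fun i => b i + 2
  have hN0 : 0 < N := by positivity
  have hQ : Q.card ≤ 4 ^ d * N := by
    refine (card_block_le _).trans_eq ?_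
    rw [Finset.sum_add_distrib, pow_add, ← hN, mul_comm]
    congr 1
    simp [pow_mul']
  have hsplit := Finset.sum_filter_add_sum_filter_not Q
    (fun k => N ≤ 2 * 4 ^ d * repCount b k) (repCount b)
  rw [sum_repCount] at hsplit
  have h1 : ∑ k ∈ Q with N ≤ 2 * 4 ^ d * repCount b k, repCount b k ≤
      (Q.filter fun k => N ≤ 2 * 4 ^ d * repCount b k).card * N :=
    Finset.sum_le_card_nsmul _ _ _ fun k _ => repCount_le b k
  have h2 : 2 * 4 ^ d * ∑ k ∈ Q with ¬ N ≤ 2 * 4 ^ d * repCount b k, repCount b k ≤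
      4 ^ d * N * N := by
    rw [Finset.mul_sum]
    refine (Finset.sum_le_card_nsmul _ _ N fun k hk => ?_).trans ?_
    · exact (not_le.1 (Finset.mem_filter.1 hk).2).le
    · rw [smul_eq_mul]
      exact Nat.mul_le_mul_right _ ((Finset.card_filter_le _ _).trans hQ)
  have h3 : 2 * ∑ k ∈ Q with ¬ N ≤ 2 * 4 ^ d * repCount b k, repCount b k ≤ N * N := by
    have h4 : 0 < 4 ^ d := by positivity
    refine Nat.le_of_mul_le_mul_left ?_ h4
    linarith
  rw [← hN] at hsplit
  refine Nat.le_of_mul_le_mul_right (c := N) ?_ hN0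
  linarith

lemma LqNorm_mul_sq_le {p : ℝ≥0∞} (hp1 : 1 < p) (hp : p ≠ ∞) (A : Finset (Fin d → ℤ)) (c : ℂ) :
    LqNorm d p (fun x => c * (∑ k ∈ A, 1 * expk d k x) ^ 2) ≤
      ‖c‖ₑ * (A.card : ℝ≥0∞) ^ (2 - 1 / p.toReal) := by
  rw [LqNorm_eq_lintegral (zero_lt_one.trans hp1).ne' hp]
  set P := p.toReal with hP
  have hP1 : 1 < P := by
    have := (ENNReal.toReal_lt_toReal (by norm_num) hp).2 hp1
    simpa using this
  have hP0 : 0 < P := by linarith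
  set D : (Fin d → ℝ) → ℂ := fun x => ∑ k ∈ A, 1 * expk d k x with hD
  have hDle : ∀ x, ‖D x‖ₑ ≤ A.card := fun x => by
    refine (enorm_sum_le _ _).trans ?_
    refine (Finset.sum_le_sum (g := fun _ => 1) fun k _ => ?_).trans (by simp)
    rw [one_mul, ← ofReal_norm, norm_expk, ENNReal.ofReal_one]
  have hD2 : ∫⁻ x in cube d, ‖D x‖ₑ ^ 2 = A.card := by
    rw [hD, lintegral_sum_expk_sq]
    simp
  have hK : ‖c‖ₑ ^ P * (A.card : ℝ≥0∞) ^ (2 * P - 2) ≠ ∞ :=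
    ENNReal.mul_ne_top (ENNReal.rpow_ne_top_of_nonneg hP0.le enorm_ne_top)
      (ENNReal.rpow_ne_top_of_nonneg (by linarith) (ENNReal.natCast_ne_top _))
  have hle : ∫⁻ x in cube d, ‖c * D x ^ 2‖ₑ ^ P ≤
      ‖c‖ₑ ^ P * (A.card : ℝ≥0∞) ^ (2 * P - 2) * A.card := by
    rw [← hD2, ← lintegral_const_mul' _ _ (by rw [hD2]; exact hK), hD2]
    refine lintegral_mono fun x => ?_
    dsimp only
    rw [enorm_mul, ENNReal.mul_rpow_of_nonneg _ _ hP0.le, mul_assoc]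
    refine mul_le_mul_right ?_ _
    rw [enorm_pow, ← ENNReal.rpow_two, ← ENNReal.rpow_mul]
    calc ‖D x‖ₑ ^ (2 * P) = ‖D x‖ₑ ^ (2 * P - 2) * ‖D x‖ₑ ^ (2 : ℝ) := by
          rw [← ENNReal.rpow_add_of_nonneg _ _ (by linarith) (by norm_num), sub_add_cancel]
      _ ≤ _ := mul_le_mul_left (ENNReal.rpow_le_rpow (hDle x) (by linarith)) _
  refine (ENNReal.rpow_le_rpow hle (by positivity)).trans_eq ?_
  rw [mul_assoc, ENNReal.mul_rpow_of_nonneg _ _ (by positivity), ← ENNReal.rpow_mul,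
    mul_one_div_cancel hP0.ne', ENNReal.rpow_one]
  congr 1
  conv_lhs => rw [← ENNReal.rpow_one (A.card : ℝ≥0∞), ← ENNReal.rpow_mul, one_mul]
  rw [← ENNReal.rpow_add_of_nonneg _ _ (by linarith) (by norm_num), ← ENNReal.rpow_mul]
  congr 1
  field_simp
  ring

/-- A sum of squared Dirichlet kernels over the dyadic blocks `I_{b+2}`, `b ∈ J`. -/
def testFun (J : Finset (Fin d → ℕ)) (c : ℝ) (x : Fin d → ℝ) : ℂ :=
  ∑ k ∈ J.biUnion (fun b => block fun i => b i + 2),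
    ((c * ∑ b ∈ J, (repCount b k : ℝ) : ℝ) : ℂ) * expk d k x

lemma integrableOn_testFun (J : Finset (Fin d → ℕ)) (c : ℝ) :
    IntegrableOn (testFun J c) (cube d) :=
  integrableOn_sum_expk _ _

lemma fCoeff_testFun (J : Finset (Fin d → ℕ)) (c : ℝ) (k : Fin d → ℤ) :
    fCoeff d (testFun J c) k = ((c * ∑ b ∈ J, (repCount b k : ℝ) : ℝ) : ℂ) := by
  refine (fCoeff_sum_expk (J.biUnion fun b => block fun i => b i + 2)
    (fun k => ((c * ∑ b ∈ J, (repCount b k : ℝ) : ℝ) : ℂ)) k).trans ?_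
  split_ifs with h
  · rfl
  · rw [Finset.sum_eq_zero fun b hb => ?_]
    · simp
    · rw [repCount_eq_zero fun hk => h (Finset.mem_biUnion.2 ⟨b, hb, hk⟩), Nat.cast_zero]

lemma sum_repCount_eq_of_mem {J : Finset (Fin d → ℕ)} {b : Fin d → ℕ} (hb : b ∈ J)
    {k : Fin d → ℤ} (hk : k ∈ block fun i => b i + 2) :
    ∑ b' ∈ J, (repCount b' k : ℝ) = repCount b k := by
  refine Finset.sum_eq_single_of_mem b hb fun b' _ hne => ?_
  rw [repCount_eq_zero fun hk' => hne ?_, Nat.cast_zero]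
  funext i
  have := congrFun (block_unique hk' hk) i
  omega

lemma blockProj_testFun_of_mem {J : Finset (Fin d → ℕ)} {b : Fin d → ℕ} (hb : b ∈ J) (c : ℝ) :
    blockProj d (testFun J c) (fun i => b i + 2) =
      fun x => (c : ℂ) * (∑ k ∈ halfBox b, 1 * expk d k x) ^ 2 := by
  funext x
  rw [← sum_repCount_expk, Finset.mul_sum, blockProj]
  refine Finset.sum_congr rfl fun k hk => ?_
  rw [fCoeff_testFun, sum_repCount_eq_of_mem hb hk]
  push_cast
  ring

lemma blockProj_testFun_of_notMem {J : Finset (Fin d → ℕ)} {j : Fin d → ℕ}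
    (hj : j ∉ J.image fun b i => b i + 2) (c : ℝ) :
    blockProj d (testFun J c) j = fun _ => 0 := by
  funext x
  refine Finset.sum_eq_zero fun k hk => ?_
  rw [fCoeff_testFun, Finset.sum_eq_zero fun b hb => ?_]
  · simp
  · rw [repCount_eq_zero fun hk' => hj (Finset.mem_image.2 ⟨b, hb, block_unique hk' hk⟩),
      Nat.cast_zero]

lemma besovNorm_testFun_le {p θ : ℝ≥0∞} (hp1 : 1 < p) (hp : p ≠ ∞) (hθ : 0 < θ) (hθtop : θ ≠ ∞)
    (r : ℝ) {n : ℕ} {J : Finset (Fin d → ℕ)} (hJ : ∀ b ∈ J, ∑ i, b i = n) {c : ℝ} (hc : 0 ≤ c) :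
    besovNorm d r p θ (testFun J c) ≤ ENNReal.ofReal
      ((J.card : ℝ) ^ (1 / θ.toReal) * (2 : ℝ) ^ (((n : ℝ) + 2 * d) * r) * c *
        ((2 : ℝ) ^ n) ^ (2 - 1 / p.toReal)) := by
  set P := p.toReal with hP
  set T := θ.toReal with hT
  have hT0 : 0 < T := ENNReal.toReal_pos hθ.ne' hθtop
  set B : ℝ≥0∞ := (2 : ℝ≥0∞) ^ (((n : ℝ) + 2 * d) * r) *
    (ENNReal.ofReal c * ((2 : ℝ≥0∞) ^ n) ^ (2 - 1 / P)) with hB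
  have hterm : ∀ j ∈ J.image fun b i => b i + 2,
      ((2 : ℝ≥0∞) ^ (((∑ i, j i : ℕ) : ℝ) * r) * LqNorm d p (blockProj d (testFun J c) j)) ^ T ≤
        B ^ T := by
    intro j hj
    obtain ⟨b, hb, rfl⟩ := Finset.mem_image.1 hj
    refine ENNReal.rpow_le_rpow ?_ hT0.le
    have hs : ((∑ i, (b i + 2) : ℕ) : ℝ) = (n : ℝ) + 2 * d := by
      rw [Finset.sum_add_distrib, hJ b hb]
      simp [mul_comm]
    rw [hs, hB, blockProj_testFun_of_mem hb]
    refine mul_le_mul_right ?_ _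
    refine (LqNorm_mul_sq_le hp1 hp _ _).trans_eq ?_
    rw [card_halfBox, hJ b hb, ← ofReal_norm, Complex.norm_real, Real.norm_of_nonneg hc]
    push_cast
    rfl
  have hsum : ∑' j : Fin d → ℕ, ((2 : ℝ≥0∞) ^ (((∑ i, j i : ℕ) : ℝ) * r) *
      LqNorm d p (blockProj d (testFun J c) j)) ^ T ≤ J.card * B ^ T := by
    rw [tsum_eq_sum (s := J.image fun b i => b i + 2) fun j hj => ?_]
    · refine (Finset.sum_le_card_nsmul _ _ _ hterm).trans ?_
      rw [nsmul_eq_mul]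
      exact mul_le_mul_left (by exact_mod_cast Finset.card_image_le) _
    · rw [blockProj_testFun_of_notMem hj, LqNorm, show (fun _ : Fin d → ℝ => (0 : ℂ)) = 0 from rfl,
        eLpNorm_zero, mul_zero, ENNReal.zero_rpow_of_pos hT0]
  rw [besovNorm, if_neg hθtop]
  simp only [ofReal_two_rpow]
  refine (ENNReal.rpow_le_rpow hsum (by positivity)).trans_eq ?_
  rw [ENNReal.mul_rpow_of_nonneg _ _ (by positivity), ← ENNReal.rpow_mul,
    mul_one_div_cancel hT0.ne', ENNReal.rpow_one, hB]
  rw [ENNReal.ofReal_mul (by positivity), ENNReal.ofReal_mul (by positivity),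
    ENNReal.ofReal_mul (by positivity), ofReal_two_rpow,
    ← ENNReal.ofReal_rpow_of_nonneg (by positivity) (by positivity), ENNReal.ofReal_natCast,
    ← ENNReal.ofReal_rpow_of_pos (by positivity), ENNReal.ofReal_pow (by positivity),
    ENNReal.ofReal_ofNat]
  ring

lemma le_sigmaF_testFun (η : ℝ≥0∞) (hη : η ≠ 0) {n m : ℕ} {J : Finset (Fin d → ℕ)}
    (hJ : ∀ b ∈ J, ∑ i, b i = n) {c : ℝ} (hc : 0 ≤ c) (hm : 0 < m) (hmJ : 4 * m ≤ J.card * 2 ^ n) :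
    ENNReal.ofReal (c * 2 ^ n / (2 * 4 ^ d) * ((J.card : ℝ) * 2 ^ n / 4) ^ (1 / η.toReal)) ≤
      sigmaF d m (wienerNorm d 0 η) (testFun J c) := by
  set G : Finset (Fin d → ℤ) := J.biUnion fun b => (block fun i => b i + 2).filter fun k =>
      2 ^ n ≤ 2 * 4 ^ d * repCount b k with hG
  have hGcard : J.card * 2 ^ n ≤ 2 * G.card := by
    rw [hG, Finset.card_biUnion, Finset.mul_sum, ← smul_eq_mul]
    · refine Finset.card_nsmul_le_sum _ _ _ fun b hb => ?_
      have := card_le_two_mul_card_filter_repCount b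
      rwa [hJ b hb] at this
    · intro b _ b' _ hne
      refine Finset.disjoint_left.2 fun k hk hk' => hne ?_
      funext i
      have := congrFun (block_unique (Finset.mem_filter.1 hk).1 (Finset.mem_filter.1 hk').1) i
      omega
  have hcoeff : ∀ k ∈ G, ENNReal.ofReal (c * 2 ^ n / (2 * 4 ^ d)) ≤
      ‖fCoeff d (testFun J c) k‖ₑ := by
    intro k hk
    obtain ⟨b, hb, hkb⟩ := Finset.mem_biUnion.1 hk
    obtain ⟨hkb, hrep⟩ := Finset.mem_filter.1 hkb
    rw [fCoeff_testFun, sum_repCount_eq_of_mem hb hkb, ← ofReal_norm, Complex.norm_real,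
      Real.norm_of_nonneg (by positivity)]
    refine ENNReal.ofReal_le_ofReal ?_
    rw [mul_div_assoc]
    refine mul_le_mul_of_nonneg_left ?_ hc
    rw [div_le_iff₀ (by positivity), mul_comm]
    exact_mod_cast hrep
  refine le_iInf₂ fun s hs => ?_
  obtain ⟨Λ, a, hΛ, rfl⟩ := hs
  have hdiff : J.card * 2 ^ n ≤ 4 * (G \ Λ).card := by
    have := Finset.le_card_sdiff Λ G
    omega
  have hcoeff' : ∀ k ∈ G \ Λ, ENNReal.ofReal (c * 2 ^ n / (2 * 4 ^ d)) ≤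
      ‖fCoeff d (testFun J c - fun x => ∑ k ∈ Λ, a k * expk d k x) k‖ₑ := by
    intro k hk
    obtain ⟨hkG, hkΛ⟩ := Finset.mem_sdiff.1 hk
    rw [fCoeff_sub (integrableOn_testFun J c) (integrableOn_sum_expk _ _), fCoeff_sum_expk,
      if_neg hkΛ, sub_zero]
    exact hcoeff k hkG
  rw [wienerNorm_zero]
  split_ifs with hηtop
  · obtain ⟨k, hk⟩ : (G \ Λ).Nonempty := Finset.card_pos.1 (by omega)
    refine le_trans ?_ ((hcoeff' k hk).trans (le_iSup (fun k => ‖fCoeff d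
      (testFun J c - fun x => ∑ k ∈ Λ, a k * expk d k x) k‖ₑ) k))
    simp [hηtop]
  · have hE0 : 0 < η.toReal := ENNReal.toReal_pos hη hηtop
    rw [← ENNReal.rpow_le_rpow_iff hE0, ← ENNReal.rpow_mul, one_div_mul_cancel hE0.ne',
      ENNReal.rpow_one, ENNReal.ofReal_mul (by positivity), ENNReal.mul_rpow_of_nonneg _ _ hE0.le,
      ← ENNReal.ofReal_rpow_of_nonneg (by positivity) (by positivity), ← ENNReal.rpow_mul,
      one_div_mul_cancel hE0.ne', ENNReal.rpow_one]
    have hcard : ENNReal.ofReal ((J.card : ℝ) * 2 ^ n / 4) ≤ (G \ Λ).card := by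
      rw [← ENNReal.ofReal_natCast]
      refine ENNReal.ofReal_le_ofReal ?_
      rw [div_le_iff₀ (by norm_num), mul_comm _ (4 : ℝ)]
      exact_mod_cast hdiff
    refine le_trans ?_ (ENNReal.sum_le_tsum (G \ Λ))
    refine le_trans ?_ (Finset.card_nsmul_le_sum _ _ _ fun k hk =>
      ENNReal.rpow_le_rpow (hcoeff' k hk) hE0.le)
    rw [nsmul_eq_mul, mul_comm]
    exact mul_le_mul_left hcard _

/-- There are `L^(d-1)` multi-indices `b ∈ ℕ₀^d` with `‖b‖₁ = d L`. -/
lemma exists_indices (hd : 1 ≤ d) (L : ℕ) :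
    ∃ J : Finset (Fin d → ℕ), J.card = L ^ (d - 1) ∧ ∀ b ∈ J, ∑ i, b i = d * L := by
  obtain ⟨e, rfl⟩ : ∃ e, d = e + 1 := ⟨d - 1, by omega⟩
  refine ⟨(Fintype.piFinset fun _ : Fin e => Finset.range L).image fun a =>
    (Fin.snoc a ((e + 1) * L - ∑ i, a i) : Fin (e + 1) → ℕ), ?_, ?_⟩
  · rw [Finset.card_image_of_injOn]
    · simp [Fintype.card_piFinset]
    · intro a _ a' _ h
      have := congrArg (fun b : Fin (e + 1) → ℕ => Fin.init b) h
      simpa using this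
  · intro b hb
    obtain ⟨a, ha, rfl⟩ := Finset.mem_image.1 hb
    have hle : ∑ i, a i ≤ e * L := by
      refine (Finset.sum_le_card_nsmul _ _ L fun i _ => ?_).trans_eq (by simp)
      exact (Finset.mem_range.1 (Fintype.mem_piFinset.1 ha i)).le
    rw [Fin.sum_univ_castSucc]
    simp only [Fin.snoc_castSucc, Fin.snoc_last]
    have : (e + 1) * L = e * L + L := by ring
    omega

/-- Lower bound for the best `m`-term widths. -/
lemma le_sigmaClass {p θ η : ℝ≥0∞} (hd : 1 ≤ d) (hp1 : 1 < p) (hp : p ≠ ∞) (hθ : 0 < θ)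
    (hθtop : θ ≠ ∞) (hη : η ≠ 0) (r : ℝ) {m L : ℕ} (hm : 0 < m)
    (hmL : 4 * m ≤ L ^ (d - 1) * 2 ^ (d * L)) :
    ENNReal.ofReal (((2 : ℝ) ^ (2 * d * r))⁻¹ / (2 * 4 ^ d) * (1 / 4) ^ (1 / η.toReal) *
      ((((L : ℝ) ^ (d - 1)) * 2 ^ (d * L)) ^ (-(r + 1 - 1 / p.toReal - 1 / η.toReal)) *
        ((L : ℝ) ^ (d - 1)) ^ (r + 1 - 1 / p.toReal - 1 / θ.toReal))) ≤
      sigmaClass d m (besovNorm d r p θ) (wienerNorm d 0 η) := by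
  obtain ⟨J, hJcard, hJ⟩ := exists_indices hd L
  have hV0 : (0 : ℝ) < (L : ℝ) ^ (d - 1) := by
    have : 0 < L ^ (d - 1) := Nat.pos_of_mul_pos_right (b := 2 ^ (d * L)) (by omega)
    exact_mod_cast this
  set V : ℝ := (L : ℝ) ^ (d - 1) with hV
  have hJV : (J.card : ℝ) = V := by rw [hJcard, hV]; push_cast; rfl
  set N : ℝ := (2 : ℝ) ^ (d * L) with hN
  have hN0 : 0 < N := by positivity
  set P := p.toReal
  set T := θ.toReal
  set c : ℝ := (V ^ (1 / T) * (2 : ℝ) ^ ((((d * L : ℕ) : ℝ) + 2 * d) * r) *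
    N ^ (2 - 1 / P))⁻¹ with hc
  have hc0 : 0 < c := by positivity
  have hbes : besovNorm d r p θ (testFun J c) ≤ 1 := by
    refine (besovNorm_testFun_le hp1 hp hθ hθtop r hJ hc0.le).trans_eq ?_
    rw [hJV, mul_right_comm _ c, hc, mul_inv_cancel₀ (by positivity), ENNReal.ofReal_one]
  have hle := le_sigmaF_testFun η hη hJ hc0.le hm (by rw [hJcard]; exact hmL)
  refine le_trans (le_of_eq ?_) (hle.trans
    (le_iSup₂ (f := fun f _ => sigmaF d m (wienerNorm d 0 η) f) (testFun J c)
      ⟨integrableOn_testFun J c, hbes⟩))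
  congr 1
  have hpow : (2 : ℝ) ^ ((((d * L : ℕ) : ℝ) + 2 * d) * r) = N ^ r * 2 ^ (2 * d * r) := by
    rw [hN, ← Real.rpow_natCast, ← Real.rpow_mul (by norm_num), ← Real.rpow_add (by norm_num)]
    congr 1
    ring
  set E := η.toReal
  have hVexp : V ^ (-(r + 1 - 1 / P - 1 / E)) * V ^ (r + 1 - 1 / P - 1 / T) =
      (V ^ (1 / T))⁻¹ * V ^ (1 / E) := by
    rw [← Real.rpow_neg hV0.le, ← Real.rpow_add hV0, ← Real.rpow_add hV0]
    congr 1
    ring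
  have hNexp : N ^ (-(r + 1 - 1 / P - 1 / E)) =
      (N ^ r)⁻¹ * (N ^ (2 - 1 / P))⁻¹ * N * N ^ (1 / E) := by
    conv_rhs => rw [← Real.rpow_neg hN0.le, ← Real.rpow_neg hN0.le, ← Real.rpow_add hN0,
      ← Real.rpow_add_one hN0.ne', ← Real.rpow_add hN0]
    congr 1
    ring
  rw [hJV, hc, hpow, Real.mul_rpow hV0.le hN0.le, hNexp, div_eq_mul_one_div (V * N) 4,
    Real.mul_rpow (by positivity) (by norm_num), Real.mul_rpow hV0.le hN0.le]
  calc _ = ((2 : ℝ) ^ (2 * d * r))⁻¹ / (2 * 4 ^ d) * (1 / 4) ^ (1 / E) *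
        ((N ^ r)⁻¹ * (N ^ (2 - 1 / P))⁻¹ * N * N ^ (1 / E)) *
        (V ^ (-(r + 1 - 1 / P - 1 / E)) * V ^ (r + 1 - 1 / P - 1 / T)) := by ring
    _ = _ := by
        rw [hVexp, mul_inv, mul_inv, mul_inv]
        ring

end LowerBound

section Asymptotics

lemma one_le_logStar (m : ℕ) : 1 ≤ logStar m := le_max_right _ _

/-- `m` eventually dominates every power of `log* m`. -/
lemma eventually_mul_logStar_pow_le (K : ℝ) (e : ℕ) :
    ∃ m₀ : ℕ, ∀ m : ℕ, m₀ ≤ m → K * logStar m ^ e ≤ m := by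
  have h1 : (fun x : ℝ => (K * (Real.log 2)⁻¹ ^ e) * Real.log x ^ e) =o[Filter.atTop] fun x => x :=
    (isLittleO_pow_log_id_atTop (n := e)).const_mul_left _
  have h2 := (h1.bound one_pos).and (Filter.eventually_ge_atTop 2)
  have h3 := (tendsto_natCast_atTop_atTop (R := ℝ)).eventually h2
  obtain ⟨m₀, hm₀⟩ := Filter.eventually_atTop.1 h3
  refine ⟨m₀, fun m hm => ?_⟩
  obtain ⟨hb, h2m⟩ := hm₀ m hm
  have hlog : logStar m = (Real.log 2)⁻¹ * Real.log m := by
    rw [logStar, max_eq_left, Real.logb, div_eq_inv_mul]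
    rw [Real.le_logb_iff_rpow_le one_lt_two (by linarith), Real.rpow_one]
    exact h2m
  rw [hlog, mul_pow, ← mul_assoc]
  rw [one_mul, Real.norm_of_nonneg (Nat.cast_nonneg m)] at hb
  exact (le_abs_self _).trans hb

/-- The level of the hyperbolic cross used for `m`-term approximation. -/
lemma exists_level (e : ℕ) : ∃ m₀ : ℕ, ∀ m : ℕ, m₀ ≤ m → 0 < m ∧ ∃ n : ℕ,
    2 * (n ^ e * 2 ^ n) ≤ m ∧ (m : ℝ) / (4 * logStar m ^ e) ≤ 2 ^ n := by
  obtain ⟨m₀, hm₀⟩ := eventually_mul_logStar_pow_le 2 e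
  refine ⟨max m₀ 1, fun m hm => ?_⟩
  have hm1 : 1 ≤ m := (le_max_right _ _).trans hm
  have hm1' : (1 : ℝ) ≤ m := by exact_mod_cast hm1
  have hl := one_le_logStar m
  have hl0 : 0 < logStar m ^ e := by positivity
  have hX : 1 ≤ (m : ℝ) / (2 * logStar m ^ e) := by
    rw [one_le_div (by positivity)]
    exact hm₀ m ((le_max_left _ _).trans hm)
  obtain ⟨n, hn1, hn2⟩ := exists_nat_pow_near hX one_lt_two
  refine ⟨hm1, n, ?_, ?_⟩
  · have hXm : (m : ℝ) / (2 * logStar m ^ e) ≤ m :=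
      div_le_self (by positivity) (by nlinarith [one_le_pow₀ (n := e) hl])
    have hnl : (n : ℝ) ≤ logStar m := by
      refine le_max_of_le_left ?_
      rw [Real.le_logb_iff_rpow_le one_lt_two (by linarith), Real.rpow_natCast]
      exact hn1.trans hXm
    have h1 : (n : ℝ) ^ e ≤ logStar m ^ e := pow_le_pow_left₀ (Nat.cast_nonneg n) hnl e
    have h2 : (2 : ℝ) * (n ^ e * 2 ^ n) ≤ m := by
      calc (2 : ℝ) * (n ^ e * 2 ^ n)
          ≤ 2 * (logStar m ^ e * (m / (2 * logStar m ^ e))) := by gcongr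
        _ = m := by field_simp
    exact_mod_cast h2
  · rw [pow_succ] at hn2
    have : (m : ℝ) / (4 * logStar m ^ e) = m / (2 * logStar m ^ e) / 2 := by
      rw [div_div]
      ring_nf
    rw [this]
    linarith

/-- The number of frequencies used in the lower bound. -/
lemma exists_size {d : ℕ} (hd : 1 ≤ d) {m : ℕ} (hm : 0 < m) : ∃ L : ℕ,
    4 * m ≤ L ^ (d - 1) * 2 ^ (d * L) ∧ L ^ (d - 1) * 2 ^ (d * L) ≤ 4 ^ d * (4 * m) ∧
      logStar m ≤ 2 * d * L := by
  have hex : ∃ L : ℕ, 1 ≤ L ∧ 4 * m ≤ L ^ (d - 1) * 2 ^ (d * L) := by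
    refine ⟨4 * m, by omega, ?_⟩
    have h1 : 4 * m ≤ 2 ^ (d * (4 * m)) :=
      (Nat.le_mul_of_pos_left _ hd).trans Nat.lt_two_pow_self.le
    exact h1.trans (Nat.le_mul_of_pos_left _ (pow_pos (by omega) _))
  classical
  obtain ⟨hL1, hL4⟩ := Nat.find_spec hex
  set L := Nat.find hex with hL
  refine ⟨L, hL4, ?_, ?_⟩
  · rcases Nat.lt_or_ge L 2 with h | h
    · have : L = 1 := by omega
      rw [this, one_pow, one_mul, mul_one]
      calc 2 ^ d ≤ 4 ^ d := Nat.pow_le_pow_left (by norm_num) d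
        _ ≤ 4 ^ d * (4 * m) := Nat.le_mul_of_pos_right _ (by omega)
    · have hmin := Nat.find_min hex (m := L - 1) (by omega)
      obtain ⟨l, hl⟩ : ∃ l, L = l + 1 := ⟨L - 1, by omega⟩
      rw [hl, Nat.add_sub_cancel] at hmin
      have hl1 : 1 ≤ l := by omega
      have hlt : l ^ (d - 1) * 2 ^ (d * l) ≤ 4 * m := by
        by_contra hcon
        exact hmin ⟨hl1, by omega⟩
      rw [hl]
      calc (l + 1) ^ (d - 1) * 2 ^ (d * (l + 1))
          ≤ (2 * l) ^ (d - 1) * 2 ^ (d * (l + 1)) := by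
            gcongr
            omega
        _ = 2 ^ (d - 1) * 2 ^ d * (l ^ (d - 1) * 2 ^ (d * l)) := by ring
        _ ≤ 2 ^ d * 2 ^ d * (4 * m) := by
            gcongr
            · norm_num
            · omega
        _ = 4 ^ d * (4 * m) := by rw [← mul_pow, show 2 * 2 = 4 from rfl]
  · have hLR : (1 : ℝ) ≤ L := by exact_mod_cast hL1
    have hdR : (1 : ℝ) ≤ d := by exact_mod_cast hd
    refine max_le ?_ (by nlinarith)
    have h1 : m ≤ 2 ^ (2 * d * L) := by
      calc m ≤ 4 * m := by omega
        _ ≤ L ^ (d - 1) * 2 ^ (d * L) := hL4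
        _ ≤ (2 ^ L) ^ d * 2 ^ (d * L) := by
            refine Nat.mul_le_mul_right _ ?_
            exact (Nat.pow_le_pow_right hL1 (by omega)).trans
              (Nat.pow_le_pow_left Nat.lt_two_pow_self.le d)
        _ = 2 ^ (2 * d * L) := by
            rw [← pow_mul, ← pow_add]
            congr 1
            ring
    rw [Real.logb_le_iff_le_rpow one_lt_two (by exact_mod_cast hm)]
    have : (2 : ℝ) ^ (2 * (d : ℝ) * L) = ((2 ^ (2 * d * L) : ℕ) : ℝ) := by
      rw [Nat.cast_pow, ← Real.rpow_natCast]
      push_cast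
      rfl
    rw [this]
    exact_mod_cast h1

end Asymptotics

/-- `σ_m(S^r_{p,θ}B)_{A_η}` for `1 < p ≤ 2`, `0 < θ ≤ 2`,
`θ ≤ η ≤ ∞` and `r > 1/p + 1/θ - 1`. -/
theorem statement14 (d : ℕ) (hd : 1 ≤ d) (p θ η : ℝ≥0∞) (hp1 : 1 < p) (hp2 : p ≤ 2)
    (hθ : 0 < θ) (hθ2 : θ ≤ 2) (hθη : θ ≤ η) (r : ℝ)
    (hr : 1/p.toReal + 1/θ.toReal - 1 < r) :
    IsAsympEquiv (fun m => sigmaClass d m (besovNorm d r p θ) (wienerNorm d 0 η))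
      (fun m => (m : ℝ) ^ (-(r + 1 - 1/p.toReal - 1/η.toReal)) *
        logStar m ^ (((d : ℝ) - 1) * (r + 1 - 1/p.toReal - 1/θ.toReal))) := by
  have hptop : p ≠ ∞ := ne_top_of_le_ne_top (by norm_num) hp2
  have hθtop : θ ≠ ∞ := ne_top_of_le_ne_top (by norm_num) hθ2
  have hη : η ≠ 0 := (hθ.trans_le hθη).ne'
  have hT0 : 0 < θ.toReal := ENNReal.toReal_pos hθ.ne' hθtop
  have hηθ : 1 / η.toReal ≤ 1 / θ.toReal := by
    rcases eq_or_ne η ∞ with rfl | hηtop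
    · simp
    · exact one_div_le_one_div_of_le hT0 ((ENNReal.toReal_le_toReal hθtop hηtop).2 hθη)
  have hcast : ((d - 1 : ℕ) : ℝ) = (d : ℝ) - 1 := by rw [Nat.cast_sub hd, Nat.cast_one]
  obtain ⟨s, hs⟩ : ∃ s, s = r + 1 - 1 / p.toReal - 1 / θ.toReal := ⟨_, rfl⟩
  obtain ⟨α, hα⟩ : ∃ α, α = r + 1 - 1 / p.toReal - 1 / η.toReal := ⟨_, rfl⟩
  have hs0 : 0 < s := by rw [hs]; linarith
  have hα0 : 0 ≤ α := by rw [hα]; linarith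
  have hlogpow : ∀ m : ℕ, logStar m ^ (((d : ℝ) - 1) * s) = (logStar m ^ (d - 1)) ^ s := by
    intro m
    rw [← hcast, Real.rpow_mul (by linarith [one_le_logStar m]), Real.rpow_natCast]
  obtain ⟨m₀, hm₀⟩ := exists_level (d - 1)
  set C₀ : ℝ := ((2 : ℝ) ^ (2 * d * r))⁻¹ / (2 * 4 ^ d) * (1 / 4) ^ (1 / η.toReal) with hC₀
  have hd0 : (0 : ℝ) < d := by exact_mod_cast hd
  refine ⟨C₀ * ((4 : ℝ) ^ d * 4) ^ (-α) * ((2 * (d : ℝ)) ^ (d - 1))⁻¹ ^ s,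
    4 ^ s * (1 / 2) ^ (1 / η.toReal - 1 / θ.toReal), by positivity, by positivity, m₀,
    fun m hm => ?_⟩
  obtain ⟨hm0, n, hn1, hn2⟩ := hm₀ m hm
  have hmR : (0 : ℝ) < m := by exact_mod_cast hm0
  have hl0 : 0 < logStar m := by linarith [one_le_logStar m]
  dsimp only
  rw [← hs, ← hα, hlogpow]
  constructor
  · obtain ⟨L, hL1, hL2, hL3⟩ := exists_size hd hm0
    have hle := le_sigmaClass hd hp1 hptop hθ hθtop hη r hm0 hL1
    refine le_trans (ENNReal.ofReal_le_ofReal ?_) hle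
    rw [← hs, ← hα, ← hC₀]
    have hY0 : (0 : ℝ) < (L : ℝ) ^ (d - 1) * 2 ^ (d * L) := by
      have : 0 < L ^ (d - 1) * 2 ^ (d * L) := by omega
      exact_mod_cast this
    have hY : (L : ℝ) ^ (d - 1) * 2 ^ (d * L) ≤ (4 : ℝ) ^ d * 4 * m := by
      rw [mul_assoc]
      exact_mod_cast hL2
    have h1 : ((4 : ℝ) ^ d * 4) ^ (-α) * (m : ℝ) ^ (-α) ≤
        ((L : ℝ) ^ (d - 1) * 2 ^ (d * L)) ^ (-α) := by
      rw [← Real.mul_rpow (by positivity) hmR.le]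
      exact Real.rpow_le_rpow_of_nonpos hY0 hY (by linarith)
    have h2 : ((2 * (d : ℝ)) ^ (d - 1))⁻¹ ^ s * (logStar m ^ (d - 1)) ^ s ≤
        ((L : ℝ) ^ (d - 1)) ^ s := by
      rw [← Real.mul_rpow (by positivity) (by positivity)]
      refine Real.rpow_le_rpow (by positivity) ?_ hs0.le
      rw [inv_mul_le_iff₀ (by positivity), ← mul_pow]
      exact pow_le_pow_left₀ hl0.le hL3 _
    calc C₀ * ((4 : ℝ) ^ d * 4) ^ (-α) * ((2 * (d : ℝ)) ^ (d - 1))⁻¹ ^ s *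
          ((m : ℝ) ^ (-α) * (logStar m ^ (d - 1)) ^ s)
        = C₀ * ((((4 : ℝ) ^ d * 4) ^ (-α) * (m : ℝ) ^ (-α)) *
          (((2 * (d : ℝ)) ^ (d - 1))⁻¹ ^ s * (logStar m ^ (d - 1)) ^ s)) := by ring
      _ ≤ _ := by gcongr
  · refine iSup₂_le fun f hf => ?_
    refine (sigmaF_le hd hp1 hp2 hθ hθ2 hθη hr hf.1 hf.2 hm0 hn1).trans ?_
    rw [← hs]
    have hM : (m : ℝ≥0∞) / 2 = ENNReal.ofReal ((m : ℝ) / 2) := by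
      rw [ENNReal.ofReal_div_of_pos two_pos, ENNReal.ofReal_natCast, ENNReal.ofReal_ofNat]
    rw [hM, ← ofReal_two_rpow, ENNReal.ofReal_rpow_of_pos (by positivity),
      ← ENNReal.ofReal_mul (by positivity)]
    refine ENNReal.ofReal_le_ofReal ?_
    have h1 : (2 : ℝ) ^ (-(s * n)) ≤ 4 ^ s * ((m : ℝ) ^ (-s) * (logStar m ^ (d - 1)) ^ s) := by
      calc (2 : ℝ) ^ (-(s * n)) = ((2 : ℝ) ^ n) ^ (-s) := by
            rw [← Real.rpow_natCast, ← Real.rpow_mul two_pos.le]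
            congr 1
            ring
        _ ≤ ((m : ℝ) / (4 * logStar m ^ (d - 1))) ^ (-s) :=
            Real.rpow_le_rpow_of_nonpos (by positivity) hn2 (by linarith)
        _ = _ := by
            rw [Real.div_rpow hmR.le (by positivity), Real.mul_rpow (by norm_num) (by positivity),
              Real.rpow_neg (show (0 : ℝ) ≤ 4 by norm_num),
              Real.rpow_neg (show 0 ≤ logStar m ^ (d - 1) by positivity)]
            field_simp
    have h2 : ((m : ℝ) / 2) ^ (1 / η.toReal - 1 / θ.toReal) =
        (1 / 2) ^ (1 / η.toReal - 1 / θ.toReal) * (m : ℝ) ^ (1 / η.toReal - 1 / θ.toReal) := by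
      rw [← Real.mul_rpow (by norm_num) hmR.le]
      congr 1
      ring
    have h3 : (m : ℝ) ^ (-s) * (m : ℝ) ^ (1 / η.toReal - 1 / θ.toReal) = (m : ℝ) ^ (-α) := by
      rw [← Real.rpow_add hmR]
      congr 1
      rw [hs, hα]
      ring
    rw [h2, ← h3]
    refine (mul_le_mul_of_nonneg_right h1 (by positivity)).trans_eq ?_
    ring

end Paper
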